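/- arXiv:math/0702833 — 7 statements merged into one kernel-verified Lean document; each statement's English description precedes it below -/
import Mathlib

section
/- Let P, Q ∈ SL(2,ℝ) with P hyperbolic (|tr(P)| > 2), and assume |tr([P,Q])| ≠ 2, where [P,Q] = P⁻¹Q⁻¹PQ. Then lim_{n→∞} L([Pⁿ,Q])/(2n) = L(P), where L denotes translation length. -/
open UpperHalfPlane Matrix
open scoped MatrixGroups

/-- The translation length of `P ∈ SL(2,ℝ)` acting by Möbius transformations
on the upper half-plane with the hyperbolic metric:
`L(P) = inf_{z ∈ ℍ} dist(z, P·z)`. -/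
noncomputable def transLen (P : SL(2, ℝ)) : ℝ := ⨅ z : ℍ, dist z (P • z)

/-- The diagonal matrix `X^t = diag(e^{t/2}, e^{-t/2})`, as an element of `SL(2,ℝ)`. -/
noncomputable def Xmat (t : ℝ) : SL(2, ℝ) :=
  ⟨!![Real.exp (t / 2), 0; 0, Real.exp (-(t / 2))], by
    simp [Matrix.det_fin_two_of, ← Real.exp_add]⟩

/-- The displacement of `z` under `A`, in terms of the real quadratic form fixed by `A`. -/
lemma cosh_dist_smul (A : SL(2, ℝ)) (z : ℍ) :
    Real.cosh (dist z (A • z)) = (A 0 0 + A 1 1) ^ 2 / 2 - 1 +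
      ((A 1 0 * (z.re ^ 2 + z.im ^ 2) + (A 1 1 - A 0 0) * z.re - A 0 1) / z.im) ^ 2 / 2 := by
  have hdet : A 0 0 * A 1 1 - A 0 1 * A 1 0 = 1 := by
    rw [← Matrix.det_fin_two, A.det_coe]
  have hy : 0 < z.im := z.im_pos
  have hd : (A 1 0 : ℂ) * z + A 1 1 ≠ 0 := by
    simpa [UpperHalfPlane.denom] using UpperHalfPlane.denom_ne_zero (A : GL (Fin 2) ℝ) z
  have hN : 0 < Complex.normSq ((A 1 0 : ℂ) * z + A 1 1) := Complex.normSq_pos.2 hd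
  have him : (A • z).im = z.im / Complex.normSq ((A 1 0 : ℂ) * z + A 1 1) := by
    have him' := UpperHalfPlane.im_smul_eq_div_normSq
      (Matrix.SpecialLinearGroup.map (algebraMap ℝ ℝ) A : GL (Fin 2) ℝ) z
    change (A • z).im = _ at him'
    simpa [UpperHalfPlane.denom] using him'
  have hsub : (z : ℂ) - ((A • z : ℍ) : ℂ) =
      (A 1 0 * z ^ 2 + (A 1 1 - A 0 0) * z - A 0 1) / ((A 1 0 : ℂ) * z + A 1 1) := by
    rw [UpperHalfPlane.coe_specialLinearGroup_apply]
    simp only [Algebra.algebraMap_self, RingHom.id_apply]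
    rw [eq_div_iff hd, sub_mul, div_mul_cancel₀ _ hd]
    ring
  have hnum : Complex.normSq (A 1 0 * (z : ℂ) ^ 2 + (A 1 1 - A 0 0) * z - A 0 1) =
      z.im ^ 2 * ((A 0 0 + A 1 1) ^ 2 - 4) +
        (A 1 0 * (z.re ^ 2 + z.im ^ 2) + (A 1 1 - A 0 0) * z.re - A 0 1) ^ 2 := by
    simp only [Complex.normSq_apply, pow_two, Complex.add_re, Complex.sub_re, Complex.mul_re,
      Complex.add_im, Complex.sub_im, Complex.mul_im, Complex.ofReal_re, Complex.ofReal_im,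
      UpperHalfPlane.coe_re, UpperHalfPlane.coe_im]
    linear_combination (-4 * z.im ^ 2) * hdet
  rw [UpperHalfPlane.cosh_dist, dist_eq_norm, hsub, ← Complex.normSq_eq_norm_sq, map_div₀, hnum,
    him]
  field_simp
  ring

/-- A hyperbolic element of `SL(2,ℝ)` has a point on its axis. -/
lemma exists_mem_axis (A : SL(2, ℝ)) (hA : 4 < (A 0 0 + A 1 1) ^ 2) :
    ∃ z : ℍ, A 1 0 * (z.re ^ 2 + z.im ^ 2) + (A 1 1 - A 0 0) * z.re - A 0 1 = 0 := by
  have hdet : A 0 0 * A 1 1 - A 0 1 * A 1 0 = 1 := by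
    rw [← Matrix.det_fin_two, A.det_coe]
  by_cases hc : A 1 0 = 0
  · have hda : A 1 1 - A 0 0 ≠ 0 := by
      intro h
      rw [hc] at hdet
      nlinarith
    refine ⟨⟨⟨A 0 1 / (A 1 1 - A 0 0), 1⟩, one_pos⟩, ?_⟩
    simp only [UpperHalfPlane.re, UpperHalfPlane.im, hc]
    field_simp
    ring
  · have hD : 0 < (A 0 0 + A 1 1) ^ 2 - 4 := by linarith
    refine ⟨⟨⟨(A 0 0 - A 1 1) / (2 * A 1 0), √((A 0 0 + A 1 1) ^ 2 - 4) / (2 * |A 1 0|)⟩,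
      div_pos (Real.sqrt_pos.2 hD) (by positivity)⟩, ?_⟩
    simp only [UpperHalfPlane.re, UpperHalfPlane.im]
    rw [div_pow, div_pow, Real.sq_sqrt hD.le, mul_pow, mul_pow, sq_abs]
    field_simp
    linear_combination 4 * hdet

/-- The translation length of a hyperbolic element is determined by its trace. -/
lemma transLen_eq_of_abs_trace (A : SL(2, ℝ)) {h : ℝ} (hh : 0 < h)
    (hA : |Matrix.trace (A : Matrix (Fin 2) (Fin 2) ℝ)| = 2 * Real.cosh h) :
    transLen A = 2 * h := by
  rw [Matrix.trace_fin_two] at hA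
  have hsq : (A 0 0 + A 1 1) ^ 2 = 4 * Real.cosh h ^ 2 := by
    rw [← sq_abs, hA]
    ring
  have hcosh : (A 0 0 + A 1 1) ^ 2 / 2 - 1 = Real.cosh (2 * h) := by
    rw [hsq, Real.cosh_two_mul, Real.sinh_sq]
    ring
  have hlow (z : ℍ) : 2 * h ≤ dist z (A • z) := by
    have : Real.cosh (2 * h) ≤ Real.cosh (dist z (A • z)) := by
      rw [cosh_dist_smul, hcosh]
      linarith [sq_nonneg ((A 1 0 * (z.re ^ 2 + z.im ^ 2) + (A 1 1 - A 0 0) * z.re - A 0 1) / z.im)]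
    rwa [Real.cosh_le_cosh, abs_of_pos (by linarith), abs_of_nonneg dist_nonneg] at this
  obtain ⟨z, hz⟩ := exists_mem_axis A (by
    rw [hsq]
    nlinarith [Real.one_lt_cosh.2 hh.ne'])
  have hattain : dist z (A • z) = 2 * h := by
    have : Real.cosh (dist z (A • z)) = Real.cosh (2 * h) := by
      rw [cosh_dist_smul, hcosh, hz]
      simp
    exact Real.cosh_injOn (Set.mem_Ici.2 dist_nonneg) (Set.mem_Ici.2 (by linarith)) this
  exact le_antisymm (hattain ▸ ciInf_le ⟨2 * h, by rintro _ ⟨w, rfl⟩; exact hlow w⟩ z)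
    (le_ciInf hlow)

/-- Cayley–Hamilton for the powers of a `2 × 2` matrix of determinant one. -/
lemma sinh_smul_pow_eq (P : SL(2, ℝ)) {s h : ℝ} (hs : s ^ 2 = 1)
    (hP : Matrix.trace (P : Matrix (Fin 2) (Fin 2) ℝ) = s * (2 * Real.cosh h)) (n : ℕ) :
    Real.sinh h • (P : Matrix (Fin 2) (Fin 2) ℝ) ^ n =
      (s ^ (n + 1) * Real.sinh (n * h)) • (P : Matrix (Fin 2) (Fin 2) ℝ) -
        (s ^ n * Real.sinh ((n - 1) * h)) • (1 : Matrix (Fin 2) (Fin 2) ℝ) := by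
  have hsq : (P : Matrix (Fin 2) (Fin 2) ℝ) * P =
      (s * (2 * Real.cosh h)) • (P : Matrix (Fin 2) (Fin 2) ℝ) - 1 := by
    have hdet : P 0 0 * P 1 1 - P 0 1 * P 1 0 = 1 := by
      rw [← Matrix.det_fin_two, P.det_coe]
    rw [← hP, Matrix.trace_fin_two]
    ext i j
    fin_cases i <;> fin_cases j <;> simp [Matrix.mul_apply, Fin.sum_univ_two] <;>
      linarith
  induction n with
  | zero => simp
  | succ n ih =>
    have hsinh : Real.sinh ((n + 1) * h) =
        2 * Real.cosh h * Real.sinh (n * h) - Real.sinh ((n - 1) * h) := by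
      rw [add_mul, sub_mul, one_mul, Real.sinh_add, Real.sinh_sub]
      ring
    rw [pow_succ, ← smul_mul_assoc, ih, sub_mul, smul_mul_assoc, smul_mul_assoc, one_mul, hsq]
    push_cast
    rw [hsinh, add_sub_cancel_right, smul_sub, smul_smul, sub_right_comm, ← sub_smul]
    congr 2
    linear_combination s ^ n * Real.sinh ((n - 1) * h) * hs

/-- The trace of a commutator is quadratic along the pencil spanned by a matrix and the identity. -/
lemma trace_commutator_pencil (P Q B : SL(2, ℝ)) (u v : ℝ)
    (hB : (B : Matrix (Fin 2) (Fin 2) ℝ) = u • (P : Matrix (Fin 2) (Fin 2) ℝ) + v • 1) :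
    Matrix.trace ((B⁻¹ * Q⁻¹ * B * Q : SL(2, ℝ)) : Matrix (Fin 2) (Fin 2) ℝ) - 2 =
      u ^ 2 *
        (Matrix.trace ((P⁻¹ * Q⁻¹ * P * Q : SL(2, ℝ)) : Matrix (Fin 2) (Fin 2) ℝ) - 2) := by
  have hdetP : P 0 0 * P 1 1 - P 0 1 * P 1 0 = 1 := by
    rw [← Matrix.det_fin_two, P.det_coe]
  have hdetQ : Q 0 0 * Q 1 1 - Q 0 1 * Q 1 0 = 1 := by
    rw [← Matrix.det_fin_two, Q.det_coe]
  have hdetB : B 0 0 * B 1 1 - B 0 1 * B 1 0 = 1 := by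
    rw [← Matrix.det_fin_two, B.det_coe]
  have h00 : B 0 0 = u * P 0 0 + v := by simp [hB]
  have h01 : B 0 1 = u * P 0 1 := by simp [hB]
  have h10 : B 1 0 = u * P 1 0 := by simp [hB]
  have h11 : B 1 1 = u * P 1 1 + v := by simp [hB]
  rw [h00, h01, h10, h11] at hdetB
  simp only [Matrix.trace_fin_two, Matrix.SpecialLinearGroup.coe_mul,
    Matrix.SpecialLinearGroup.coe_inv, Matrix.adjugate_fin_two, Matrix.mul_apply,
    Fin.sum_univ_two, Matrix.of_apply, Matrix.cons_val_zero, Matrix.cons_val_one,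
    Matrix.cons_val', Matrix.cons_val_fin_one]
  rw [h00, h01, h10, h11]
  linear_combination 2 * hdetB - 2 * u ^ 2 * hdetP +
    (2 * u * v * (P 0 0 + P 1 1) + 2 * v ^ 2) * hdetQ

/-- Asymptotics of `arcosh` along a sequence growing like `e^{2nh}`. -/
lemma tendsto_arcosh_div {h K : ℝ} (hh : 0 < h) (hK : K ≠ 0) :
    (∀ᶠ n : ℕ in Filter.atTop, 1 < |1 + K * Real.sinh (n * h) ^ 2|) ∧
    Filter.Tendsto (fun n : ℕ => Real.arcosh |1 + K * Real.sinh (n * h) ^ 2| / n)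
      Filter.atTop (nhds (2 * h)) := by
  set x : ℕ → ℝ := fun n => |1 + K * Real.sinh (n * h) ^ 2| with hx
  have hcast : Filter.Tendsto (fun n : ℕ => (n : ℝ)) Filter.atTop Filter.atTop :=
    tendsto_natCast_atTop_atTop
  have hlin : Filter.Tendsto (fun n : ℕ => 2 * (n * h)) Filter.atTop Filter.atTop :=
    (hcast.atTop_mul_const hh).const_mul_atTop two_pos
  have hexp : Filter.Tendsto (fun n : ℕ => Real.exp (-(2 * (n * h)))) Filter.atTop (nhds 0) :=
    Real.tendsto_exp_neg_atTop_nhds_zero.comp hlin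
  have hxe : Filter.Tendsto (fun n => x n * Real.exp (-(2 * (n * h)))) Filter.atTop
      (nhds (|K| / 4)) := by
    have hlim : Filter.Tendsto (fun n : ℕ => |Real.exp (-(2 * (n * h))) +
        K * ((1 - Real.exp (-(2 * (n * h)))) ^ 2 / 4)|) Filter.atTop
        (nhds |0 + K * ((1 - 0) ^ 2 / 4)|) :=
      (hexp.add ((((hexp.const_sub 1).pow 2).div_const 4).const_mul K)).abs
    have h4 : |0 + K * ((1 - 0) ^ 2 / 4)| = |K| / 4 := by
      rw [zero_add, sub_zero, one_pow, mul_one_div, abs_div, abs_of_pos (by norm_num : (0 : ℝ) < 4)]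
    rw [h4] at hlim
    refine hlim.congr fun n => ?_
    have he : Real.exp (-(2 * (n * h))) = Real.exp (-(n * h)) ^ 2 := by
      rw [← Real.exp_nat_mul]
      push_cast
      ring_nf
    have h1 : Real.exp (n * h) * Real.exp (-(n * h)) = 1 := by
      rw [← Real.exp_add]
      simp
    rw [hx, ← abs_of_pos (Real.exp_pos (-(2 * (n * h)))), ← abs_mul,
      abs_of_pos (Real.exp_pos (-(2 * (n * h)))), Real.sinh_eq, he]
    congr 1
    linear_combination (-K / 4 * (Real.exp (n * h) * Real.exp (-(n * h)) + 1
      - 2 * Real.exp (-(n * h)) ^ 2)) * h1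
  have hK4 : 0 < |K| / 4 := by positivity
  have hgrow : Filter.Tendsto x Filter.atTop Filter.atTop := by
    refine (hxe.pos_mul_atTop hK4 (Real.tendsto_exp_atTop.comp hlin)).congr fun n => ?_
    simp only [Function.comp_apply]
    rw [mul_assoc, ← Real.exp_add]
    simp
  have hone : ∀ᶠ n in Filter.atTop, 1 < x n := hgrow.eventually_gt_atTop 1
  refine ⟨hone, ?_⟩
  have hdiff : Filter.Tendsto (fun n : ℕ => Real.arcosh (x n) - 2 * (n * h)) Filter.atTop
      (nhds (Real.log (|K| / 4 + √((|K| / 4) ^ 2 - 0 ^ 2)))) := by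
    have hlim := (hxe.add ((hxe.pow 2).sub (hexp.pow 2)).sqrt).log (by positivity)
    refine hlim.congr' ?_
    filter_upwards [hone] with n hn
    have hpos := Real.exp_pos (-(2 * (n * h)))
    have hfac : (x n * Real.exp (-(2 * (n * h)))) ^ 2 - Real.exp (-(2 * (n * h))) ^ 2 =
        (x n ^ 2 - 1) * Real.exp (-(2 * (n * h))) ^ 2 := by
      ring
    rw [hfac, Real.sqrt_mul' _ (sq_nonneg _), Real.sqrt_sq hpos.le, ← add_mul,
      ← Real.exp_arcosh hn.le, ← Real.exp_add, Real.log_exp]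
    ring
  have hsum := (hdiff.div_atTop hcast).add_const (2 * h)
  rw [zero_add] at hsum
  refine hsum.congr' ?_
  filter_upwards [Filter.eventually_gt_atTop 0] with n hn
  have : (n : ℝ) ≠ 0 := by positivity
  field_simp
  ring

/-- Let `P, Q ∈ SL(2,ℝ)` with `P` hyperbolic (`|tr P| > 2`) and suppose that the
commutator `[P,Q] = P⁻¹Q⁻¹PQ` satisfies `|tr [P,Q]| ≠ 2` (i.e. it is neither central
nor parabolic).  Then `L([Pⁿ,Q])/(2n) → L(P)` as `n → ∞`. -/
theorem translation_length_commutator_limit (P Q : SL(2, ℝ))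
    (hP : |Matrix.trace (P : Matrix (Fin 2) (Fin 2) ℝ)| > 2)
    (hPQ : |Matrix.trace ((P⁻¹ * Q⁻¹ * P * Q : SL(2, ℝ)) : Matrix (Fin 2) (Fin 2) ℝ)| ≠ 2) :
    Filter.Tendsto
      (fun n : ℕ => transLen ((P ^ n)⁻¹ * Q⁻¹ * P ^ n * Q) / (2 * (n : ℝ)))
      Filter.atTop (nhds (transLen P)) := by
  set t := Matrix.trace (P : Matrix (Fin 2) (Fin 2) ℝ) with ht
  set τ := Matrix.trace ((P⁻¹ * Q⁻¹ * P * Q : SL(2, ℝ)) : Matrix (Fin 2) (Fin 2) ℝ) with hτ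
  obtain ⟨h, hh, habs⟩ : ∃ h : ℝ, 0 < h ∧ |t| = 2 * Real.cosh h :=
    ⟨Real.arcosh (|t| / 2), Real.arcosh_pos (by linarith), by
      rw [Real.cosh_arcosh (by linarith)]
      ring⟩
  obtain ⟨s, hs, hts⟩ : ∃ s : ℝ, s ^ 2 = 1 ∧ t = s * (2 * Real.cosh h) := by
    rcases abs_choice t with ht' | ht'
    · exact ⟨1, by norm_num, by linarith⟩
    · exact ⟨-1, by norm_num, by linarith⟩
  have hsinh : 0 < Real.sinh h := Real.sinh_pos_iff.2 hh
  have hτ2 : τ - 2 ≠ 0 := by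
    intro h0
    exact hPQ (by rw [sub_eq_zero.1 h0]; norm_num)
  have htrace (n : ℕ) : |Matrix.trace (((P ^ n)⁻¹ * Q⁻¹ * P ^ n * Q : SL(2, ℝ)) :
      Matrix (Fin 2) (Fin 2) ℝ)| =
        2 * |1 + (τ - 2) / (2 * Real.sinh h ^ 2) * Real.sinh (n * h) ^ 2| := by
    have hpow := sinh_smul_pow_eq P hs hts n
    have hpencil := trace_commutator_pencil P Q (P ^ n)
      (s ^ (n + 1) * Real.sinh (n * h) / Real.sinh h)
      (-(s ^ n * Real.sinh ((n - 1) * h) / Real.sinh h)) (by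
        rw [Matrix.SpecialLinearGroup.coe_pow,
          ← inv_smul_smul₀ hsinh.ne' ((P : Matrix (Fin 2) (Fin 2) ℝ) ^ n), hpow,
          smul_sub, smul_smul, smul_smul, _root_.neg_smul, ← sub_eq_add_neg, div_eq_inv_mul,
          div_eq_inv_mul])
    have hsn : (s ^ (n + 1)) ^ 2 = 1 := by rw [← pow_mul, mul_comm, pow_mul, hs, one_pow]
    rw [div_pow, mul_pow, hsn, ← hτ] at hpencil
    rw [← abs_two, ← abs_mul, abs_two, eq_add_of_sub_eq hpencil]
    congr 1
    field_simp
    ring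
  obtain ⟨hone, hlim⟩ := tendsto_arcosh_div hh
    (div_ne_zero hτ2 (by positivity : 2 * Real.sinh h ^ 2 ≠ 0))
  rw [transLen_eq_of_abs_trace P hh habs]
  refine hlim.congr' ?_
  filter_upwards [hone] with n hn
  rw [transLen_eq_of_abs_trace _ (Real.arcosh_pos hn)
    (by rw [htrace, Real.cosh_arcosh hn.le]), mul_div_mul_left _ _ two_ne_zero]
end

section
/- Let Γ be a cocompact lattice of SL(2,ℝ). If P ∈ SL(2,ℝ) commutes with every element of Γ, then P = 1 or P = −1, i.e. P lies in the center of SL(2,ℝ). -/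
open Matrix
open scoped MatrixGroups

/-- The standard topology on `SL(2,ℝ)` as a matrix group: the subspace topology
induced from the space of `2×2` real matrices. -/
instance : TopologicalSpace SL(2, ℝ) :=
  TopologicalSpace.induced (fun P : SL(2, ℝ) => (P : Matrix (Fin 2) (Fin 2) ℝ))
    inferInstance

/-- If `P` commutes with a cocompact subgroup `Γ` of `SL(2,ℝ)`, then the matrix entries of the
conjugates of `P` are bounded. -/
theorem exists_bound_conj_of_commute (Γ : Subgroup SL(2, ℝ)) [CompactSpace (SL(2, ℝ) ⧸ Γ)]
    (P : SL(2, ℝ)) (hP : ∀ γ ∈ Γ, P * γ = γ * P) (i j : Fin 2) :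
    ∃ C : ℝ, ∀ g : SL(2, ℝ),
      |((g : Matrix (Fin 2) (Fin 2) ℝ) * (P : Matrix (Fin 2) (Fin 2) ℝ) * adjugate (g : Matrix (Fin 2) (Fin 2) ℝ)) i j| ≤ C := by
  have hcoe : Continuous (fun g : SL(2, ℝ) => (g : Matrix (Fin 2) (Fin 2) ℝ)) :=
    continuous_induced_dom
  have hcont : Continuous (fun g : SL(2, ℝ) =>
      ((g : Matrix (Fin 2) (Fin 2) ℝ) * (P : Matrix (Fin 2) (Fin 2) ℝ) *
        adjugate (g : Matrix (Fin 2) (Fin 2) ℝ)) i j) :=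
    ((hcoe.matrix_mul continuous_const).matrix_mul hcoe.matrix_adjugate).matrix_elem i j
  have hwd : ∀ a b : SL(2, ℝ), QuotientGroup.leftRel Γ a b →
      ((a : Matrix (Fin 2) (Fin 2) ℝ) * (P : Matrix (Fin 2) (Fin 2) ℝ) * adjugate (a : Matrix (Fin 2) (Fin 2) ℝ)) i j =
        ((b : Matrix (Fin 2) (Fin 2) ℝ) * (P : Matrix (Fin 2) (Fin 2) ℝ) * adjugate (b : Matrix (Fin 2) (Fin 2) ℝ)) i j := by
    intro a b hab
    have h := hP _ (QuotientGroup.leftRel_apply.mp hab)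
    have h' : a * P * a⁻¹ = b * P * b⁻¹ := by
      calc a * P * a⁻¹ = a * (P * (a⁻¹ * b)) * b⁻¹ := by group
        _ = b * P * b⁻¹ := by rw [h]; group
    exact congrArg (fun g : SL(2, ℝ) => (g : Matrix (Fin 2) (Fin 2) ℝ) i j) h'
  obtain ⟨C, hC⟩ := (isCompact_range (hcont.quotient_lift hwd)).isBounded.exists_norm_le
  exact ⟨C, fun g => hC _ ⟨Quotient.mk _ g, rfl⟩⟩

theorem eq_zero_of_forall_abs_add_mul_le {a c C : ℝ} (h : ∀ t : ℝ, |a + t * c| ≤ C) : c = 0 := by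
  by_contra hc
  have h₁ := h ((C + 1 - a) / c)
  rw [div_mul_cancel₀ _ hc, add_sub_cancel] at h₁
  linarith [le_abs_self (C + 1)]

/-- Let `Γ` be a cocompact lattice of `SL(2,ℝ)`, i.e. a discrete subgroup with compact
quotient `SL(2,ℝ)/Γ`.  If `P ∈ SL(2,ℝ)` commutes with every element of `Γ`, then
`P = 1` or `P = -1`, i.e. `P` lies in the center of `SL(2,ℝ)`. -/
theorem commuting_with_cocompact_lattice_central (Γ : Subgroup SL(2, ℝ))
    [DiscreteTopology Γ] [CompactSpace (SL(2, ℝ) ⧸ Γ)]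
    (P : SL(2, ℝ)) (hP : ∀ γ ∈ Γ, P * γ = γ * P) :
    (P : Matrix (Fin 2) (Fin 2) ℝ) = 1 ∨ (P : Matrix (Fin 2) (Fin 2) ℝ) = -1 := by
  let U (t : ℝ) : SL(2, ℝ) := ⟨!![1, t; 0, 1], by simp [det_fin_two]⟩
  let L (t : ℝ) : SL(2, ℝ) := ⟨!![1, 0; t, 1], by simp [det_fin_two]⟩
  have hc : P 1 0 = 0 := by
    obtain ⟨C, hC⟩ := exists_bound_conj_of_commute Γ P hP 0 0
    refine eq_zero_of_forall_abs_add_mul_le (a := P 0 0) (C := C) fun t => ?_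
    convert hC (U t) using 2
    simp [U, mul_apply, vecMul, dotProduct, Fin.sum_univ_two, adjugate_fin_two]
  have hb : P 0 1 = 0 := by
    obtain ⟨C, hC⟩ := exists_bound_conj_of_commute Γ P hP 1 1
    refine eq_zero_of_forall_abs_add_mul_le (a := P 1 1) (C := C) fun t => ?_
    convert hC (L t) using 2
    simp [L, mul_apply, vecMul, dotProduct, Fin.sum_univ_two, adjugate_fin_two]
    ring
  have hd : P 1 1 - P 0 0 = 0 := by
    obtain ⟨C, hC⟩ := exists_bound_conj_of_commute Γ P hP 0 1
    refine eq_zero_of_forall_abs_add_mul_le (a := P 0 1) (C := C) fun t => ?_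
    convert hC (U t) using 2
    simp [U, mul_apply, vecMul, dotProduct, Fin.sum_univ_two, adjugate_fin_two, hc]
    ring
  have hdet : P 0 0 * P 0 0 = 1 := by
    have h := P.det_coe
    rw [det_fin_two, hb, hc, sub_eq_zero.mp hd] at h
    linarith
  rcases mul_self_eq_one_iff.mp hdet with h | h
  · left
    ext i j
    fin_cases i <;> fin_cases j <;> simp [hb, hc, h, sub_eq_zero.mp hd]
  · right
    ext i j
    fin_cases i <;> fin_cases j <;> simp [hb, hc, h, sub_eq_zero.mp hd]
end

section
/- Let Γ be a cocompact lattice of SL(2,ℝ). Then Γ contains no parabolic element: if γ ∈ Γ satisfies |tr(γ)| = 2, then γ = 1 or γ = −1. -/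
open Matrix
open scoped MatrixGroups

open Filter Topology

instance : IsTopologicalGroup SL(2, ℝ) where
  continuous_mul := by
    have h : Continuous fun P : SL(2, ℝ) => (P : Matrix (Fin 2) (Fin 2) ℝ) :=
      continuous_induced_dom
    exact continuous_induced_rng.mpr
      ((h.comp continuous_fst).matrix_mul (h.comp continuous_snd))
  continuous_inv := by
    have h : Continuous fun P : SL(2, ℝ) => (P : Matrix (Fin 2) (Fin 2) ℝ) :=
      continuous_induced_dom
    exact continuous_induced_rng.mpr h.matrix_adjugate

theorem Subgroup.eventually_nhds_one_eq_one_of_discrete {G : Type*} [Group G] [TopologicalSpace G]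
    (Γ : Subgroup G) [DiscreteTopology Γ] : ∀ᶠ x in 𝓝 (1 : G), x ∈ Γ → x = 1 := by
  have h : ({1} : Set Γ) ∈ 𝓝 (1 : Γ) := by simp
  rw [nhds_subtype_eq_comap, Filter.mem_comap] at h
  obtain ⟨t, ht, hts⟩ := h
  filter_upwards [ht] with x hx hxΓ
  exact congrArg Subtype.val (hts (show (⟨x, hxΓ⟩ : Γ) ∈ Subtype.val ⁻¹' t from hx))

/-- The conjugates of a discrete cocompact subgroup are uniformly discrete. -/
theorem Subgroup.eventually_forall_conj_eq_one {G : Type*} [Group G] [TopologicalSpace G]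
    [IsTopologicalGroup G] (Γ : Subgroup G) [DiscreteTopology Γ] [CompactSpace (G ⧸ Γ)] :
    ∀ᶠ x in 𝓝 (1 : G), ∀ g : G, g⁻¹ * x * g ∈ Γ → x = 1 := by
  have key : ∀ᶠ x in 𝓝 (1 : G), ∀ y ∈ (Set.univ : Set (G ⧸ Γ)),
      ∀ g : G, (g : G ⧸ Γ) = y → g⁻¹ * x * g ∈ Γ → x = 1 := by
    refine isCompact_univ.eventually_forall_of_forall_eventually fun y _ => ?_
    obtain ⟨g, rfl⟩ := QuotientGroup.mk_surjective y
    have hcont : Tendsto (fun z : G × G => z.2⁻¹ * z.1 * z.2) (𝓝 (1, g)) (𝓝 1) := by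
      have : Continuous fun z : G × G => z.2⁻¹ * z.1 * z.2 := by fun_prop
      simpa using this.tendsto (1, g)
    have hev := hcont.eventually Γ.eventually_nhds_one_eq_one_of_discrete
    have hopen : IsOpenMap (Prod.map id (QuotientGroup.mk : G → G ⧸ Γ) : G × G → G × (G ⧸ Γ)) :=
      IsOpenMap.id.prodMap QuotientGroup.isOpenMap_coe
    filter_upwards [hopen.image_mem_nhds hev]
    rintro _ ⟨⟨x, h⟩, hx, rfl⟩ k hk hkΓ
    have hhk : h⁻¹ * k ∈ Γ := QuotientGroup.eq.mp hk.symm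
    have hmem : h⁻¹ * x * h ∈ Γ := by
      have := Γ.mul_mem (Γ.mul_mem hhk hkΓ) (Γ.inv_mem hhk)
      convert this using 1
      simp only [Prod.map_fst, id]
      group
    have h1 : h⁻¹ * x * h = 1 := hx hmem
    simpa using (conj_eq_one_iff (a := h⁻¹) (b := x)).mp (by simpa using h1)
  exact key.mono fun x hx g => hx _ trivial g rfl

/-- A subgroup that is discrete and cocompact contains no nontrivial element whose conjugacy class
accumulates at the identity. -/
theorem Subgroup.eq_one_of_tendsto_conj {G ι : Type*} [Group G] [TopologicalSpace G]
    [IsTopologicalGroup G] (Γ : Subgroup G) [DiscreteTopology Γ] [CompactSpace (G ⧸ Γ)]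
    {l : Filter ι} [l.NeBot] {u : G} (hu : u ∈ Γ) {g : ι → G}
    (hg : Tendsto (fun i => g i * u * (g i)⁻¹) l (𝓝 1)) : u = 1 := by
  obtain ⟨i, hi⟩ := (hg.eventually Γ.eventually_forall_conj_eq_one).exists
  exact conj_eq_one_iff.mp (hi (g i) (by simpa [mul_assoc] using hu))

namespace Matrix.SpecialLinearGroup

/-- The upper triangular unipotent matrix with upper right entry `b`. -/
def upperUnipotent (b : ℝ) : SL(2, ℝ) := ⟨!![1, b; 0, 1], by simp⟩

theorem coe_upperUnipotent (b : ℝ) :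
    (upperUnipotent b : Matrix (Fin 2) (Fin 2) ℝ) = !![1, b; 0, 1] := rfl

theorem continuous_upperUnipotent : Continuous upperUnipotent := by
  refine continuous_induced_rng.mpr (continuous_matrix fun i j => ?_)
  fin_cases i <;> fin_cases j <;> simp [upperUnipotent] <;> fun_prop

theorem upperUnipotent_zero : upperUnipotent 0 = 1 := by
  ext i j
  fin_cases i <;> fin_cases j <;> simp [upperUnipotent]

theorem exists_diagonal_conj_upperUnipotent (b : ℝ) {t : ℝ} (ht : t ≠ 0) :
    ∃ g : SL(2, ℝ), g * upperUnipotent b * g⁻¹ = upperUnipotent (t ^ 2 * b) := by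
  obtain ⟨g, hg⟩ : ∃ g : SL(2, ℝ), (g : Matrix (Fin 2) (Fin 2) ℝ) = !![t, 0; 0, t⁻¹] :=
    ⟨⟨_, by simp [ht]⟩, rfl⟩
  refine ⟨g, mul_inv_eq_iff_eq_mul.mpr (Subtype.ext ?_)⟩
  rw [coe_mul, coe_mul, hg, coe_upperUnipotent, coe_upperUnipotent]
  ext i j
  fin_cases i <;> fin_cases j <;> simp
  field_simp

theorem exists_conj_eq_upperUnipotent {u : SL(2, ℝ)}
    (hu : (u : Matrix (Fin 2) (Fin 2) ℝ).trace = 2) :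
    ∃ (g : SL(2, ℝ)) (b : ℝ), g * u * g⁻¹ = upperUnipotent b := by
  have hdet := u.det_coe
  rw [det_fin_two] at hdet
  rw [trace_fin_two] at hu
  by_cases hc : u 1 0 = 0
  · refine ⟨1, u 0 1, ?_⟩
    rw [hc] at hdet
    have h0 : u 0 0 = 1 := by nlinarith [sq_nonneg (u 0 0 - 1)]
    have h1 : u 1 1 = 1 := by linarith
    ext i j
    fin_cases i <;> fin_cases j <;> simp [upperUnipotent, h0, h1, hc]
  · obtain ⟨p, hp⟩ : ∃ p : SL(2, ℝ), (p : Matrix (Fin 2) (Fin 2) ℝ) =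
        !![u 0 0 - 1, -(u 1 0)⁻¹; u 1 0, 0] := ⟨⟨_, by simp [hc]⟩, rfl⟩
    have h1 : u 1 1 = 2 - u 0 0 := by linarith
    rw [h1] at hdet
    refine ⟨p⁻¹, -(u 1 0)⁻¹, ?_⟩
    rw [inv_inv, mul_assoc, inv_mul_eq_iff_eq_mul]
    refine Subtype.ext ?_
    rw [coe_mul, coe_mul, hp, coe_upperUnipotent]
    ext i j
    fin_cases i <;> fin_cases j <;> simp [mul_apply, Fin.sum_univ_two, h1, hc] <;>
      field_simp <;> linarith

/-- The conjugacy class of a unipotent element of `SL(2,ℝ)` accumulates at the identity. -/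
theorem exists_tendsto_conj_nhds_one {u : SL(2, ℝ)}
    (hu : (u : Matrix (Fin 2) (Fin 2) ℝ).trace = 2) :
    ∃ g : ℝ → SL(2, ℝ), Tendsto (fun t => g t * u * (g t)⁻¹) (𝓝[≠] 0) (𝓝 1) := by
  obtain ⟨p, b, hp⟩ := exists_conj_eq_upperUnipotent hu
  choose! d hd using fun (t : ℝ) (ht : t ≠ 0) => exists_diagonal_conj_upperUnipotent b ht
  refine ⟨fun t => d t * p, ?_⟩
  have hlim : Tendsto (fun t : ℝ => upperUnipotent (t ^ 2 * b)) (𝓝[≠] 0) (𝓝 1) := by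
    have : Continuous fun t : ℝ => upperUnipotent (t ^ 2 * b) :=
      continuous_upperUnipotent.comp (by fun_prop)
    simpa [upperUnipotent_zero] using (this.tendsto 0).mono_left nhdsWithin_le_nhds
  refine hlim.congr' ?_
  filter_upwards [self_mem_nhdsWithin] with t ht
  rw [← hd t ht, ← hp]
  group

theorem trace_sq (γ : SL(2, ℝ)) :
    ((γ ^ 2 : SL(2, ℝ)) : Matrix (Fin 2) (Fin 2) ℝ).trace =
      (γ : Matrix (Fin 2) (Fin 2) ℝ).trace ^ 2 - 2 := by
  have hdet := γ.det_coe
  rw [det_fin_two] at hdet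
  simp only [pow_two γ, coe_mul, trace_fin_two, mul_apply, Fin.sum_univ_two]
  linear_combination -2 * hdet

theorem eq_one_or_eq_neg_one_of_sq_eq_one {γ : SL(2, ℝ)} (h : γ ^ 2 = 1) :
    (γ : Matrix (Fin 2) (Fin 2) ℝ) = 1 ∨ (γ : Matrix (Fin 2) (Fin 2) ℝ) = -1 := by
  have hinv : γ = γ⁻¹ := eq_inv_of_mul_eq_one_left (by rw [← pow_two, h])
  have hadj : (γ : Matrix (Fin 2) (Fin 2) ℝ) = !![γ 1 1, -γ 0 1; -γ 1 0, γ 0 0] := by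
    conv_lhs => rw [hinv, coe_inv, adjugate_fin_two]
  have h00 : γ 0 0 = γ 1 1 := by simpa using congrFun₂ hadj 0 0
  have h01 : γ 0 1 = 0 := by
    have : γ 0 1 = -γ 0 1 := by simpa using congrFun₂ hadj 0 1
    linarith
  have h10 : γ 1 0 = 0 := by
    have : γ 1 0 = -γ 1 0 := by simpa using congrFun₂ hadj 1 0
    linarith
  have hdet := γ.det_coe
  rw [det_fin_two, h00, h01, zero_mul, sub_zero, mul_self_eq_one_iff] at hdet
  refine hdet.imp (fun h11 => ?_) fun h11 => ?_ <;> ext i j <;>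
    fin_cases i <;> fin_cases j <;> simp [h00, h01, h10, h11]

end Matrix.SpecialLinearGroup

/-- A cocompact lattice `Γ` of `SL(2,ℝ)` (a discrete subgroup with compact quotient
`SL(2,ℝ)/Γ`) contains no parabolic element: if `γ ∈ Γ` satisfies `|tr γ| = 2`, then
`γ = 1` or `γ = -1`. -/
theorem cocompact_lattice_no_parabolic (Γ : Subgroup SL(2, ℝ))
    [DiscreteTopology Γ] [CompactSpace (SL(2, ℝ) ⧸ Γ)]
    (γ : SL(2, ℝ)) (hγ : γ ∈ Γ)
    (htr : |Matrix.trace (γ : Matrix (Fin 2) (Fin 2) ℝ)| = 2) :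
    (γ : Matrix (Fin 2) (Fin 2) ℝ) = 1 ∨ (γ : Matrix (Fin 2) (Fin 2) ℝ) = -1 := by
  have htrace : ((γ ^ 2 : SL(2, ℝ)) : Matrix (Fin 2) (Fin 2) ℝ).trace = 2 := by
    rw [SpecialLinearGroup.trace_sq, ← sq_abs, htr]
    norm_num
  obtain ⟨g, hg⟩ := SpecialLinearGroup.exists_tendsto_conj_nhds_one htrace
  exact SpecialLinearGroup.eq_one_or_eq_neg_one_of_sq_eq_one
    (Γ.eq_one_of_tendsto_conj (Γ.pow_mem hγ 2) hg)
end

section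
/- Let Γ be a cocompact lattice of SL(2,ℝ). Then there exist hyperbolic elements γ₁, γ₂ ∈ Γ (i.e. |tr(γᵢ)| > 2) and a nonzero vector v ∈ ℝ² such that v is an eigenvector of γ₁ but not an eigenvector of γ₂. -/
open Matrix
open scoped MatrixGroups

/-- Cocompactness, quantitatively: every left coset of `Γ` meets a fixed bounded set. -/
theorem exists_bound_of_compactSpace_quotient (Γ : Subgroup SL(2, ℝ))
    [CompactSpace (SL(2, ℝ) ⧸ Γ)] :
    ∃ R : ℝ, 0 ≤ R ∧ ∀ g : SL(2, ℝ), ∃ γ ∈ Γ, ∀ i j, |(g * γ) i j| ≤ R := by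
  have : IsTopologicalGroup SL(2, ℝ) := Matrix.SpecialLinearGroup.topologicalGroup
  let U : ℕ → Set (SL(2, ℝ) ⧸ Γ) := fun n =>
    (QuotientGroup.mk : SL(2, ℝ) → SL(2, ℝ) ⧸ Γ) '' {g | ∀ i j, |g i j| < n}
  have hcont : Continuous fun P : SL(2, ℝ) => (P : Matrix (Fin 2) (Fin 2) ℝ) :=
    continuous_induced_dom
  have hU : ∀ n, IsOpen (U n) := by
    refine fun n => QuotientGroup.isOpenMap_coe _ ?_
    simp only [Set.ofPred_forall]
    exact isOpen_iInter_of_finite fun i => isOpen_iInter_of_finite fun j =>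
      isOpen_lt (hcont.matrix_elem i j).abs continuous_const
  have hcov : Set.univ ⊆ ⋃ n, U n := by
    intro x _
    induction x using QuotientGroup.induction_on with
    | H g =>
      obtain ⟨n, hn⟩ := exists_nat_gt (∑ i, ∑ j, |g i j|)
      refine Set.mem_iUnion.2 ⟨n, g, fun i j => lt_of_le_of_lt ?_ hn, rfl⟩
      exact (Finset.single_le_sum (f := fun j => |g i j|) (fun _ _ => abs_nonneg _)
        (Finset.mem_univ j)).trans (Finset.single_le_sum (f := fun i => ∑ j, |g i j|)
        (fun _ _ => Finset.sum_nonneg fun _ _ => abs_nonneg _) (Finset.mem_univ i))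
  have hmono : Monotone U := fun m n hmn => Set.image_mono fun g hg i j =>
    (hg i j).trans_le (Nat.cast_le.2 hmn)
  obtain ⟨n, hn⟩ := isCompact_univ.elim_directed_cover U hU hcov hmono.directed_le
  refine ⟨n, n.cast_nonneg, fun g => ?_⟩
  obtain ⟨k, hk, hkg⟩ := hn (Set.mem_univ (g : SL(2, ℝ) ⧸ Γ))
  refine ⟨g⁻¹ * k, QuotientGroup.eq.1 hkg.symm, fun i j => ?_⟩
  rw [mul_inv_cancel_left]
  exact (hk i j).le

theorem specialLinearGroup_mul_apply (A B : SL(2, ℝ)) (i j : Fin 2) :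
    (A * B) i j = A i 0 * B 0 j + A i 1 * B 1 j := by
  rw [Matrix.SpecialLinearGroup.coe_mul, Matrix.mul_apply, Fin.sum_univ_two]

theorem specialLinearGroup_det_apply (A : SL(2, ℝ)) : A 0 0 * A 1 1 - A 0 1 * A 1 0 = 1 := by
  rw [← Matrix.det_fin_two]
  exact A.2

/-- If all traces in `Γ` are at most `2` in absolute value, then `r` and `r ᵥ* δ` are linearly
dependent for every `δ ∈ Γ` and every row vector `r = (x, y)`, completed here to a matrix of
determinant one by the second row `(z, w)`. -/
theorem dependent_of_abs_trace_le_two (Γ : Subgroup SL(2, ℝ)) {R : ℝ} (hR : 0 ≤ R)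
    (hΓ : ∀ g : SL(2, ℝ), ∃ γ ∈ Γ, ∀ i j, |(g * γ) i j| ≤ R)
    (htr : ∀ γ ∈ Γ, |Matrix.trace (γ : Matrix (Fin 2) (Fin 2) ℝ)| ≤ 2)
    {δ : SL(2, ℝ)} (hδ : δ ∈ Γ) {x y z w : ℝ} (hdet : x * w - y * z = 1) :
    δ 0 1 * x ^ 2 + (δ 1 1 - δ 0 0) * x * y - δ 1 0 * y ^ 2 = 0 := by
  by_contra hD
  set a := δ 0 0 with ha
  set b := δ 0 1 with hb
  set c := δ 1 0 with hc
  set d := δ 1 1 with hd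
  set D := b * x ^ 2 + (d - a) * x * y - c * y ^ 2 with hDdef
  let C₁ := 2 + R * (|z| + |w|)
  let C₂ := 2 + R * (|z * a + w * c| + |z * b + w * d|)
  let K := R * (|x * b + y * d| * C₁ + |y| * C₂) + R * (|x| * C₂ + |x * a + y * c| * C₁)
  have hK : 0 ≤ K := by positivity
  obtain ⟨t, ht, htD⟩ : ∃ t : ℝ, 1 ≤ t ∧ K < t * |D| := by
    refine ⟨K / |D| + 1, by have : 0 ≤ K / |D| := by positivity
                            linarith, ?_⟩
    have : 0 < |D| := abs_pos.2 hD
    rw [add_mul, div_mul_cancel₀ _ this.ne']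
    linarith
  have ht0 : t ≠ 0 := by positivity
  let g : SL(2, ℝ) := ⟨!![t * x, t * y; z / t, w / t], by
    rw [Matrix.det_fin_two_of]; field_simp; linarith⟩
  have hg00 : g 0 0 = t * x := rfl
  have hg01 : g 0 1 = t * y := rfl
  have hg10 : g 1 0 = z / t := rfl
  have hg11 : g 1 1 = w / t := rfl
  clear_value g
  obtain ⟨γ, hγ, hbd⟩ := hΓ g
  set m := g * γ with hm
  have hγm : γ⁻¹ = m⁻¹ * g := by rw [hm]; group
  have hmdet : m 0 0 * m 1 1 - m 0 1 * m 1 0 = 1 := specialLinearGroup_det_apply m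
  have h₁ := htr _ (Γ.inv_mem hγ)
  have h₂ := htr _ (Γ.mul_mem hδ (Γ.inv_mem hγ))
  set p := m 1 1 with hp
  set q := - m 0 1 with hq
  set r := - m 1 0 with hr
  set s := m 0 0 with hs
  have hm00 : m⁻¹ 0 0 = p := by simp [Matrix.adjugate_fin_two, p]
  have hm01 : m⁻¹ 0 1 = q := by simp [Matrix.adjugate_fin_two, q]
  have hm10 : m⁻¹ 1 0 = r := by simp [Matrix.adjugate_fin_two, r]
  have hm11 : m⁻¹ 1 1 = s := by simp [Matrix.adjugate_fin_two, s]
  have bq : |q| ≤ R := by rw [hq, abs_neg]; exact hbd 0 1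
  have bs : |s| ≤ R := hbd 0 0
  have hdiv : ∀ {e f C : ℝ}, |t * e + f / t| ≤ 2 → |f| ≤ C → |t * e| ≤ 2 + C := by
    intro e f C h hf
    have h3 : |f / t| ≤ C := by
      rw [abs_div, abs_of_pos (by linarith : 0 < t)]
      exact (div_le_self (abs_nonneg _) ht).trans hf
    calc |t * e| = |(t * e + f / t) - f / t| := by ring_nf
      _ ≤ _ := (abs_sub _ _).trans (add_le_add h h3)
  have e₁ : |t * (x * p + y * r)| ≤ C₁ := by
    refine hdiv (f := q * z + s * w) ?_ ?_
    · convert h₁ using 2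
      rw [hγm, Matrix.trace_fin_two]
      simp only [specialLinearGroup_mul_apply, hm00, hm01, hm10, hm11, hg00, hg01, hg10, hg11]
      ring
    · calc |q * z + s * w| ≤ |q| * |z| + |s| * |w| := by
            rw [← abs_mul, ← abs_mul]; exact abs_add_le _ _
        _ ≤ R * |z| + R * |w| := by gcongr
        _ = _ := by ring
  have e₂ : |t * (x * (a * p + b * r) + y * (c * p + d * r))| ≤ C₂ := by
    refine hdiv (f := q * (z * a + w * c) + s * (z * b + w * d)) ?_ ?_
    · convert h₂ using 2
      rw [hγm, Matrix.trace_fin_two]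
      simp only [specialLinearGroup_mul_apply, hm00, hm01, hm10, hm11, hg00, hg01, hg10, hg11,
        ← ha, ← hb, ← hc, ← hd]
      ring
    · calc _ ≤ |q| * |z * a + w * c| + |s| * |z * b + w * d| := by
            rw [← abs_mul, ← abs_mul]; exact abs_add_le _ _
        _ ≤ R * |z * a + w * c| + R * |z * b + w * d| := by gcongr
        _ = _ := by ring
  set E₁ := t * (x * p + y * r) with hE₁
  set E₂ := t * (x * (a * p + b * r) + y * (c * p + d * r)) with hE₂
  have key : t * D = s * ((x * b + y * d) * E₁ - y * E₂)
      - q * (x * E₂ - (x * a + y * c) * E₁) := by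
    have : t * D = t * D * (s * p - q * r) := by
      rw [show s * p - q * r = 1 by rw [← hmdet]; ring, mul_one]
    rw [this, hE₁, hE₂, hDdef]; ring
  have : t * |D| ≤ K := by
    calc t * |D| = |t * D| := by rw [abs_mul, abs_of_pos (by linarith : 0 < t)]
      _ ≤ |s| * (|x * b + y * d| * |E₁| + |y| * |E₂|)
          + |q| * (|x| * |E₂| + |x * a + y * c| * |E₁|) := by
        rw [key]
        refine (abs_sub _ _).trans ?_
        simp only [abs_mul s, abs_mul q, ← abs_mul _ E₁, ← abs_mul _ E₂]
        exact add_le_add (mul_le_mul_of_nonneg_left (abs_sub _ _) (abs_nonneg _))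
          (mul_le_mul_of_nonneg_left (abs_sub _ _) (abs_nonneg _))
      _ ≤ R * (|x * b + y * d| * C₁ + |y| * C₂) + R * (|x| * C₂ + |x * a + y * c| * C₁) := by
        gcongr
  linarith

/-- The unipotent element `!![1, s; 0, 1]` of `SL(2, ℝ)`. -/
def upperUnipotent (s : ℝ) : SL(2, ℝ) := ⟨!![1, s; 0, 1], by simp⟩

theorem exists_two_lt_abs_trace (Γ : Subgroup SL(2, ℝ)) {R : ℝ} (hR : 0 ≤ R)
    (hΓ : ∀ g : SL(2, ℝ), ∃ γ ∈ Γ, ∀ i j, |(g * γ) i j| ≤ R) :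
    ∃ γ ∈ Γ, 2 < |Matrix.trace (γ : Matrix (Fin 2) (Fin 2) ℝ)| := by
  by_contra! htr
  obtain ⟨γ, hγ, hbd⟩ := hΓ (upperUnipotent (R + 1))
  have h₁ := dependent_of_abs_trace_le_two Γ hR hΓ htr hγ (x := 1) (y := 0) (z := 0) (w := 1)
    (by norm_num)
  have h₂ := dependent_of_abs_trace_le_two Γ hR hΓ htr hγ (x := 0) (y := 1) (z := -1) (w := 0)
    (by norm_num)
  have h₃ := dependent_of_abs_trace_le_two Γ hR hΓ htr hγ (x := 1) (y := 1) (z := 0) (w := 1)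
    (by norm_num)
  have hb : γ 0 1 = 0 := by linarith
  have hc : γ 1 0 = 0 := by linarith
  have had : γ 0 0 = γ 1 1 := by rw [hb, hc] at h₃; linarith
  have hdet : γ 0 0 * γ 1 1 - γ 0 1 * γ 1 0 = 1 := specialLinearGroup_det_apply γ
  have hd : |γ 1 1| = 1 := by
    rw [had, hb, zero_mul, sub_zero, mul_self_eq_one_iff] at hdet
    rcases hdet with h | h <;> simp [h]
  have h01 := hbd 0 1
  have : (upperUnipotent (R + 1) * γ) 0 1 = (R + 1) * γ 1 1 := by
    rw [specialLinearGroup_mul_apply, hb, mul_zero, zero_add]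
    rfl
  rw [this, abs_mul, hd, abs_of_pos (by linarith)] at h01
  linarith

/-- Two real `2 × 2` matrices with the same characteristic polynomial, of positive discriminant,
such that every eigenvector of the first is an eigenvector of the second: the second is either the
first one or its adjugate. -/
theorem eq_or_eq_adjugate_of_eigenvector {A B : Matrix (Fin 2) (Fin 2) ℝ}
    (htr : B.trace = A.trace) (hdet : B.det = A.det) (hA : 0 < A.trace ^ 2 - 4 * A.det)
    (h : ∀ v : Fin 2 → ℝ, v ≠ 0 → (∃ c : ℝ, A *ᵥ v = c • v) → ∃ c : ℝ, B *ᵥ v = c • v) :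
    B = A ∨ B = A.adjugate := by
  set τ := A.trace with hτ
  set σ := √(τ ^ 2 - 4 * A.det) with hσ
  have hσ0 : 0 < σ := Real.sqrt_pos.2 hA
  have hσ2 : σ ^ 2 = τ ^ 2 - 4 * A.det := Real.sq_sqrt hA.le
  set l := (τ + σ) / 2 with hl
  set m := (τ - σ) / 2 with hm
  have hchar : ∀ (C : Matrix (Fin 2) (Fin 2) ℝ) (c : ℝ), C.trace = τ → C.det = A.det →
      (C - c • (1 : Matrix (Fin 2) (Fin 2) ℝ)).det = (c - l) * (c - m) := by
    intro C c h₁ h₂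
    have h₃ : l * m = A.det := by rw [hl, hm]; linear_combination -(1 / 4) * hσ2
    have h₄ : l + m = τ := by rw [hl, hm]; ring
    rw [sub_mul, mul_sub, mul_sub, h₃, ← h₂, Matrix.det_fin_two, Matrix.det_fin_two]
    rw [Matrix.trace_fin_two] at h₁
    simp
    linear_combination c * h₄ - c * h₁
  have heig : ∀ (C : Matrix (Fin 2) (Fin 2) ℝ) (c : ℝ) (v : Fin 2 → ℝ),
      (C - c • (1 : Matrix (Fin 2) (Fin 2) ℝ)) *ᵥ v = 0 ↔ C *ᵥ v = c • v := by
    intro C c v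
    rw [Matrix.sub_mulVec, Matrix.smul_mulVec, Matrix.one_mulVec, sub_eq_zero]
  have hex : ∀ c, (c - l) * (c - m) = 0 → ∃ v : Fin 2 → ℝ, v ≠ 0 ∧ A *ᵥ v = c • v := by
    intro c hc
    rw [← hchar A c rfl rfl] at hc
    obtain ⟨v, hv, hv'⟩ := Matrix.exists_mulVec_eq_zero_iff.2 hc
    exact ⟨v, hv, (heig A c v).1 hv'⟩
  have hroot : ∀ (v : Fin 2 → ℝ) (c : ℝ), v ≠ 0 → B *ᵥ v = c • v → c = l ∨ c = m := by
    intro v c hv hB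
    have := Matrix.exists_mulVec_eq_zero_iff.1 ⟨v, hv, (heig B c v).2 hB⟩
    rw [hchar B c htr hdet, mul_eq_zero, sub_eq_zero, sub_eq_zero] at this
    exact this
  obtain ⟨v, hv, hAv⟩ := hex l (by ring)
  obtain ⟨w, hw, hAw⟩ := hex m (by ring)
  obtain ⟨c, hBv⟩ := h v hv ⟨l, hAv⟩
  obtain ⟨d, hBw⟩ := h w hw ⟨m, hAw⟩
  have hlm : l - m ≠ 0 := by rw [hl, hm]; ring_nf; exact hσ0.ne'
  have hli : LinearIndependent ℝ ![v, w] := by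
    rw [LinearIndependent.pair_iff]
    intro s t hst
    have h₁ := congrArg (A *ᵥ ·) hst
    simp only [Matrix.mulVec_add, Matrix.mulVec_smul, hAv, hAw, Matrix.mulVec_zero] at h₁
    have h₂ : (s * (l - m)) • v = 0 := by
      calc _ = (s • l • v + t • m • w) - m • (s • v + t • w) := by module
        _ = 0 := by rw [h₁, hst, smul_zero, sub_zero]
    have hs : s = 0 := by
      rcases smul_eq_zero.1 h₂ with h | h
      · exact (mul_eq_zero.1 h).resolve_right hlm
      · exact absurd h hv
    rw [hs, zero_smul, zero_add] at hst
    exact ⟨hs, (smul_eq_zero.1 hst).resolve_right hw⟩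
  have hext : ∀ C D : Matrix (Fin 2) (Fin 2) ℝ, C *ᵥ v = D *ᵥ v → C *ᵥ w = D *ᵥ w → C = D := by
    intro C D hv hw
    let b := basisOfLinearIndependentOfCardEqFinrank hli (by simp)
    refine Matrix.toLin'.injective (b.ext fun i => ?_)
    fin_cases i
    · simpa [b] using hv
    · simpa [b] using hw
  have hone : ∀ e : ℝ, B *ᵥ v = e • v → B *ᵥ w = e • w → 2 * e = l + m := by
    intro e h₁ h₂
    have : B = e • (1 : Matrix (Fin 2) (Fin 2) ℝ) := hext _ _
      (by rw [h₁, Matrix.smul_mulVec, Matrix.one_mulVec])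
      (by rw [h₂, Matrix.smul_mulVec, Matrix.one_mulVec])
    rw [this, Matrix.trace_smul, Matrix.trace_one] at htr
    simp at htr
    rw [hl, hm]; linarith
  have hadj : A.adjugate = τ • (1 : Matrix (Fin 2) (Fin 2) ℝ) - A := by
    rw [Matrix.adjugate_fin_two, hτ, Matrix.trace_fin_two]
    ext i j
    fin_cases i <;> fin_cases j <;> simp
  rcases hroot v c hv hBv with rfl | rfl <;> rcases hroot w d hw hBw with hd | hd <;>
    rw [hd] at hBw
  · exact absurd (hone _ hBv hBw) fun h => hlm (by linarith)
  · exact Or.inl (hext _ _ (by rw [hBv, hAv]) (by rw [hBw, hAw]))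
  · refine Or.inr (hext _ _ ?_ ?_)
    · rw [hadj, Matrix.sub_mulVec, Matrix.smul_mulVec, Matrix.one_mulVec, hBv, hAv, ← sub_smul]
      congr 1; rw [hl, hm]; ring
    · rw [hadj, Matrix.sub_mulVec, Matrix.smul_mulVec, Matrix.one_mulVec, hBw, hAw, ← sub_smul]
      congr 1; rw [hl, hm]; ring
  · exact absurd (hone _ hBv hBw) fun h => hlm (by linarith)

/-- The upper right entry of `g * A * g⁻¹` for `g` in `SL(2, ℝ)`. -/
theorem conj_apply_zero_one (g : SL(2, ℝ)) (A : Matrix (Fin 2) (Fin 2) ℝ) :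
    ((g : Matrix (Fin 2) (Fin 2) ℝ) * A * (g⁻¹ : SL(2, ℝ))) 0 1 =
      A 0 1 * g 0 0 ^ 2 + (A 1 1 - A 0 0) * g 0 0 * g 0 1 - A 1 0 * g 0 1 ^ 2 := by
  rw [Matrix.SpecialLinearGroup.coe_inv, Matrix.adjugate_fin_two]
  simp [Matrix.mul_apply, Fin.sum_univ_two]
  ring

theorem eq_zero_of_abs_quadratic_le {a b c C : ℝ} (h : ∀ s : ℝ, |a + b * s - c * s ^ 2| ≤ C) :
    b = 0 ∧ c = 0 := by
  have hlin : ∀ {k C : ℝ}, (∀ s : ℝ, 1 ≤ s → |k| * s ≤ C) → k = 0 := by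
    intro k C hk
    by_contra h0
    have hpos : 0 < |k| := abs_pos.2 h0
    have h₁ := hk (|C| / |k| + 1) (by have : 0 ≤ |C| / |k| := by positivity
                                      linarith)
    rw [mul_add, mul_div_cancel₀ _ hpos.ne'] at h₁
    linarith [le_abs_self C]
  constructor
  · refine hlin (C := C) fun s hs => ?_
    rw [← abs_of_nonneg (by linarith : 0 ≤ s), ← abs_mul]
    have h₁ := abs_le.1 (h s)
    have h₂ := abs_le.1 (h (-s))
    exact abs_le.2 ⟨by nlinarith, by nlinarith⟩
  · refine hlin (C := C + |a|) fun s hs => ?_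
    have h₁ := abs_le.1 (h s)
    have h₂ := abs_le.1 (h (-s))
    have h₃ : |c * s ^ 2| ≤ C + |a| :=
      abs_le.2 ⟨by nlinarith [neg_abs_le a], by nlinarith [le_abs_self a]⟩
    rw [abs_mul, abs_of_nonneg (sq_nonneg s)] at h₃
    exact (mul_le_mul_of_nonneg_left (by nlinarith) (abs_nonneg c)).trans h₃

/-- A cocompact lattice `Γ` of `SL(2,ℝ)` contains two hyperbolic elements
`γ₁, γ₂` (`|tr γᵢ| > 2`) together with a nonzero vector `v ∈ ℝ²` which is an
eigenvector of `γ₁` but not of `γ₂`. -/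
theorem cocompact_lattice_two_hyperbolic (Γ : Subgroup SL(2, ℝ))
    [DiscreteTopology Γ] [CompactSpace (SL(2, ℝ) ⧸ Γ)] :
    ∃ γ₁ ∈ Γ, ∃ γ₂ ∈ Γ,
      |Matrix.trace ((γ₁ : SL(2, ℝ)) : Matrix (Fin 2) (Fin 2) ℝ)| > 2 ∧
      |Matrix.trace ((γ₂ : SL(2, ℝ)) : Matrix (Fin 2) (Fin 2) ℝ)| > 2 ∧
      ∃ v : Fin 2 → ℝ, v ≠ 0 ∧
        (∃ c : ℝ, Matrix.mulVec ((γ₁ : SL(2, ℝ)) : Matrix (Fin 2) (Fin 2) ℝ) v = c • v) ∧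
        ¬(∃ c : ℝ, Matrix.mulVec ((γ₂ : SL(2, ℝ)) : Matrix (Fin 2) (Fin 2) ℝ) v = c • v) := by
  obtain ⟨R, hR, hΓ⟩ := exists_bound_of_compactSpace_quotient Γ
  obtain ⟨A, hA, hAtr⟩ := exists_two_lt_abs_trace Γ hR hΓ
  by_contra hcon
  have hdisc : 0 < (A : Matrix (Fin 2) (Fin 2) ℝ).trace ^ 2 -
      4 * (A : Matrix (Fin 2) (Fin 2) ℝ).det := by
    rw [A.2, ← sq_abs]
    nlinarith
  have hconj : ∀ γ ∈ Γ, ((γ * A * γ⁻¹ : SL(2, ℝ)) : Matrix (Fin 2) (Fin 2) ℝ) = A ∨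
      ((γ * A * γ⁻¹ : SL(2, ℝ)) : Matrix (Fin 2) (Fin 2) ℝ) =
        (A : Matrix (Fin 2) (Fin 2) ℝ).adjugate := by
    intro γ hγ
    have htr : ((γ * A * γ⁻¹ : SL(2, ℝ)) : Matrix (Fin 2) (Fin 2) ℝ).trace =
        (A : Matrix (Fin 2) (Fin 2) ℝ).trace := by
      rw [Matrix.SpecialLinearGroup.coe_mul, Matrix.trace_mul_comm,
        ← Matrix.SpecialLinearGroup.coe_mul, ← mul_assoc, inv_mul_cancel, one_mul]
    refine eq_or_eq_adjugate_of_eigenvector htr (by rw [A.2, (γ * A * γ⁻¹).2]) hdisc fun v hv hAv => ?_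
    by_contra hBv
    exact hcon ⟨A, hA, γ * A * γ⁻¹, Γ.mul_mem (Γ.mul_mem hγ hA) (Γ.inv_mem hγ), hAtr,
      by rwa [htr], v, hv, hAv, hBv⟩
  have hbound : ∀ s : ℝ, |A 0 1 + (A 1 1 - A 0 0) * s - A 1 0 * s ^ 2| ≤
      |A 0 1| * R ^ 2 + |A 1 1 - A 0 0| * R * R + |A 1 0| * R ^ 2 := by
    intro s
    obtain ⟨γ, hγ, hbd⟩ := hΓ (upperUnipotent s)
    have h₁ := conj_apply_zero_one (upperUnipotent s * γ) A
    have h₂ := conj_apply_zero_one (upperUnipotent s) (γ * A * γ⁻¹ : SL(2, ℝ))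
    have h₃ : upperUnipotent s * γ * A * (upperUnipotent s * γ)⁻¹ =
        upperUnipotent s * (γ * A * γ⁻¹) * (upperUnipotent s)⁻¹ := by group
    rw [← Matrix.SpecialLinearGroup.coe_mul, ← Matrix.SpecialLinearGroup.coe_mul] at h₁ h₂
    rw [h₃, h₂, show upperUnipotent s 0 0 = 1 from rfl, show upperUnipotent s 0 1 = s from rfl]
      at h₁
    have h₄ : |A 0 1 + (A 1 1 - A 0 0) * s - A 1 0 * s ^ 2| =
        |A 0 1 * (upperUnipotent s * γ) 0 0 ^ 2 +
          (A 1 1 - A 0 0) * (upperUnipotent s * γ) 0 0 * (upperUnipotent s * γ) 0 1 -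
            A 1 0 * (upperUnipotent s * γ) 0 1 ^ 2| := by
      rw [← h₁]
      rcases hconj γ hγ with h | h
      · rw [h]; ring_nf
      · rw [h, Matrix.adjugate_fin_two, ← abs_neg]
        simp
        ring_nf
    rw [h₄]
    refine (abs_sub _ _).trans (add_le_add ((abs_add_le _ _).trans (add_le_add ?_ ?_)) ?_)
    · rw [abs_mul, abs_pow]
      gcongr
      exact hbd 0 0
    · rw [abs_mul, abs_mul]
      gcongr
      · exact hbd 0 0
      · exact hbd 0 1
    · rw [abs_mul, abs_pow]
      gcongr
      exact hbd 0 1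
  obtain ⟨h₁, h₂⟩ := eq_zero_of_abs_quadratic_le hbound
  rw [Matrix.trace_fin_two, Matrix.det_fin_two, h₂, sub_eq_zero.1 h₁] at hdisc
  nlinarith
end

section
/- Let Γ be a cocompact lattice of SL(2,ℝ), let a : Γ → ℝ be a group homomorphism, and suppose there exists ε > 0 such that |a(γ)| ≤ (1 − ε)·L(γ) for every γ ∈ Γ with L(γ) ≠ 0, where L denotes translation length. Consider the deformed action of Γ on SL(2,ℝ) given by (γ, P) ↦ γ·P·X^{a(γ)}. Then this action is free (if γ·P·X^{a(γ)} = P for some P ∈ SL(2,ℝ), then γ = 1) and properly discontinuous (for every compact set V ⊆ SL(2,ℝ), the set {γ ∈ Γ : there exists P ∈ V with γ·P·X^{a(γ)} ∈ V} is finite). -/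
open UpperHalfPlane Matrix
open scoped MatrixGroups

instance inst_s11 : IsTopologicalGroup SL(2, ℝ) :=
  Matrix.SpecialLinearGroup.topologicalGroup

instance : T2Space SL(2, ℝ) :=
  (Matrix.SpecialLinearGroup.isClosedEmbedding_val (n := Fin 2) (R := ℝ)).isEmbedding.t2Space

theorem isProperMap_specialLinearGroup_smul_I : IsProperMap fun g : SL(2, ℝ) ↦ g • I :=
  UpperHalfPlane.isProperMap_smul_I

theorem continuous_dist_I_smul : Continuous fun g : SL(2, ℝ) ↦ dist I (g • I) :=
  continuous_const.dist isProperMap_specialLinearGroup_smul_I.continuous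

theorem dist_I_Xmat_smul (t : ℝ) : dist I (Xmat t • I) = |t| := by
  have h : ((Xmat t • I : ℍ) : ℂ) = (Real.exp t : ℂ) * Complex.I := by
    rw [coe_specialLinearGroup_apply]
    have h2 : Real.exp t = Real.exp (t / 2) / Real.exp (-(t / 2)) := by
      rw [← Real.exp_sub]
      ring_nf
    rw [h2]
    simp [Xmat]
    ring
  have hre : (Xmat t • I).re = I.re := by
    rw [← coe_re, h]
    simp [-Complex.ofReal_exp]
  have him : (Xmat t • I).im = Real.exp t := by
    rw [← coe_im, h]
    simp [-Complex.ofReal_exp]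
  rw [dist_of_re_eq hre.symm, him]
  simp [Real.dist_eq]

theorem transLen_le_dist (P : SL(2, ℝ)) (z : ℍ) : transLen P ≤ dist z (P • z) :=
  ciInf_le ⟨0, Set.forall_mem_range.2 fun _ ↦ dist_nonneg⟩ z

theorem dist_pow_smul_le (P : SL(2, ℝ)) (z : ℍ) (n : ℕ) :
    dist z (P ^ n • z) ≤ n * dist z (P • z) := by
  induction n with
  | zero => simp
  | succ n ih =>
    have h1 : dist (P ^ n • z) (P ^ (n + 1) • z) = dist z (P • z) := by
      rw [pow_succ, mul_smul, dist_smul]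
    have h2 := dist_triangle z (P ^ n • z) (P ^ (n + 1) • z)
    push_cast
    linarith

theorem finite_dist_I_smul_le (Γ : Subgroup SL(2, ℝ)) [DiscreteTopology Γ] (R : ℝ) :
    {γ : Γ | dist I ((γ : SL(2, ℝ)) • I) ≤ R}.Finite := by
  have hK : IsCompact ((fun g : SL(2, ℝ) ↦ g • I) ⁻¹' Metric.closedBall I R) :=
    isProperMap_specialLinearGroup_smul_I.isCompact_preimage (isCompact_closedBall _ _)
  have h := Γ.tendsto_coe_cofinite_of_discrete (isDiscrete_iff_discreteTopology.2 ‹_›)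
    hK.compl_mem_cocompact
  rw [Filter.mem_map, Filter.mem_cofinite] at h
  refine h.subset fun γ hγ ↦ ?_
  simpa [dist_comm] using hγ

/-- A cocompact subgroup moves every point of the upper half-plane into a fixed ball. -/
theorem exists_forall_exists_dist_smul_le (Γ : Subgroup SL(2, ℝ))
    [CompactSpace (SL(2, ℝ) ⧸ Γ)] :
    ∃ R : ℝ, ∀ z : ℍ, ∃ δ : Γ, dist I ((δ : SL(2, ℝ)) • z) ≤ R := by
  let U : ℕ → Set (SL(2, ℝ) ⧸ Γ) := fun n ↦
    (fun g : SL(2, ℝ) ↦ (g : SL(2, ℝ) ⧸ Γ)) '' {g | dist I (g • I) < n}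
  have hU : ∀ n, IsOpen (U n) := fun n ↦
    QuotientGroup.isOpenMap_coe _ (isOpen_lt continuous_dist_I_smul continuous_const)
  have hcov : (Set.univ : Set (SL(2, ℝ) ⧸ Γ)) ⊆ ⋃ n, U n := by
    intro x _
    obtain ⟨g, rfl⟩ := QuotientGroup.mk_surjective x
    obtain ⟨n, hn⟩ := exists_nat_gt (dist I (g • I))
    exact Set.mem_iUnion.2 ⟨n, g, hn, rfl⟩
  have hmono : Monotone U := fun m n hmn ↦ Set.image_mono fun g hg ↦
    lt_of_lt_of_le (Set.mem_ofPred.1 hg) (Nat.cast_le.2 hmn)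
  obtain ⟨n, hn⟩ := isCompact_univ.elim_directed_cover U hU hcov hmono.directed_le
  refine ⟨n, fun z ↦ ?_⟩
  obtain ⟨h, rfl⟩ := MulAction.exists_smul_eq SL(2, ℝ) I z
  obtain ⟨k, hk, hkh⟩ := hn (Set.mem_univ ((h⁻¹ : SL(2, ℝ)) : SL(2, ℝ) ⧸ Γ))
  refine ⟨⟨k⁻¹ * h⁻¹, QuotientGroup.eq.1 hkh⟩, ?_⟩
  have h1 : ((k⁻¹ * h⁻¹ : SL(2, ℝ)) • h • I) = k⁻¹ • I := by
    rw [mul_smul, inv_smul_smul]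
  change dist I ((k⁻¹ * h⁻¹ : SL(2, ℝ)) • h • I) ≤ n
  rw [h1, ← dist_smul k, smul_inv_smul, dist_comm]
  exact (Set.mem_ofPred.1 hk).le

/-- A homomorphism from a cocompact lattice to `ℝ` vanishes on the elements of translation
length zero. -/
theorem map_eq_zero_of_transLen_eq_zero (Γ : Subgroup SL(2, ℝ))
    [DiscreteTopology Γ] [CompactSpace (SL(2, ℝ) ⧸ Γ)]
    (a : Γ → ℝ) (ha : ∀ γ₁ γ₂ : Γ, a (γ₁ * γ₂) = a γ₁ + a γ₂)
    (γ : Γ) (hγ : transLen (γ : SL(2, ℝ)) = 0) : a γ = 0 := by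
  obtain ⟨R, hR⟩ := exists_forall_exists_dist_smul_le Γ
  obtain ⟨B, hB⟩ := ((finite_dist_I_smul_le Γ (2 * R + 1)).image fun η ↦ |a η|).bddAbove
  have hone : a 1 = 0 := by simpa using ha 1 1
  have hpow : ∀ n : ℕ, a (γ ^ n) = n * a γ := by
    intro n
    induction n with
    | zero => simpa using hone
    | succ n ih =>
      rw [pow_succ, ha, ih]
      push_cast
      ring
  have hconj : ∀ δ η : Γ, a (δ * η * δ⁻¹) = a η := by
    intro δ η
    have h := ha δ δ⁻¹
    rw [mul_inv_cancel, hone] at h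
    rw [ha, ha]
    linarith
  have hbound : ∀ n : ℕ, n * |a γ| ≤ B := by
    intro n
    obtain ⟨z, hz⟩ : ∃ z : ℍ, dist z ((γ : SL(2, ℝ)) • z) < 1 / (n + 1 : ℝ) := by
      apply exists_lt_of_ciInf_lt
      change transLen (γ : SL(2, ℝ)) < _
      rw [hγ]
      positivity
    have hz' : dist z ((γ : SL(2, ℝ)) ^ n • z) ≤ 1 := by
      refine (dist_pow_smul_le _ z n).trans ?_
      rw [lt_div_iff₀ (by positivity)] at hz
      nlinarith [dist_nonneg (x := z) (y := (γ : SL(2, ℝ)) • z)]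
    obtain ⟨δ, hδ⟩ := hR z
    have hmem : dist I (((δ * γ ^ n * δ⁻¹ : Γ) : SL(2, ℝ)) • I) ≤ 2 * R + 1 := by
      push_cast
      generalize (γ : SL(2, ℝ)) = g at *
      generalize (δ : SL(2, ℝ)) = d at *
      have h1 : dist (d • z) ((d * g ^ n * d⁻¹) • d • z) ≤ 1 := by
        rwa [mul_smul, inv_smul_smul, mul_smul, dist_smul]
      have h2 : dist ((d * g ^ n * d⁻¹) • d • z) ((d * g ^ n * d⁻¹) • I) ≤ R := by
        rwa [dist_smul, dist_comm]
      have h3 := dist_triangle4 I (d • z) ((d * g ^ n * d⁻¹) • d • z) ((d * g ^ n * d⁻¹) • I)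
      linarith
    have h := hB (Set.mem_image_of_mem (fun η ↦ |a η|) hmem)
    simpa [hconj, hpow, abs_mul] using h
  by_contra hne
  obtain ⟨n, hn⟩ := exists_nat_gt (B / |a γ|)
  rw [div_lt_iff₀ (abs_pos.2 hne)] at hn
  exact (hbound n).not_gt hn

/-- Salein's theorem (the `SL(2,ℝ)` version of Proposition 3.3 of the paper): if `Γ` is a
cocompact lattice of `SL(2,ℝ)`, `a : Γ → ℝ` is a group homomorphism, and there is `ε > 0`
with `|a(γ)| ≤ (1-ε)·L(γ)` whenever `L(γ) ≠ 0`, then the deformed action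
`(γ, P) ↦ γ·P·X^{a(γ)}` of `Γ` on `SL(2,ℝ)` is free and properly discontinuous. -/
theorem deformed_action_free_properly_discontinuous (Γ : Subgroup SL(2, ℝ))
    [DiscreteTopology Γ] [CompactSpace (SL(2, ℝ) ⧸ Γ)]
    (a : Γ → ℝ) (ha : ∀ γ₁ γ₂ : Γ, a (γ₁ * γ₂) = a γ₁ + a γ₂)
    (hε : ∃ ε > 0, ∀ γ : Γ, transLen (γ : SL(2, ℝ)) ≠ 0 →
      |a γ| ≤ (1 - ε) * transLen (γ : SL(2, ℝ))) :
    (∀ (γ : Γ) (P : SL(2, ℝ)), (γ : SL(2, ℝ)) * P * Xmat (a γ) = P → γ = 1) ∧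
    (∀ V : Set SL(2, ℝ), IsCompact V →
      {γ : Γ | ∃ P ∈ V, (γ : SL(2, ℝ)) * P * Xmat (a γ) ∈ V}.Finite) := by
  obtain ⟨c, hc0, hc1, hc⟩ : ∃ c : ℝ, 0 ≤ c ∧ c < 1 ∧
      ∀ (γ : Γ) (z : ℍ), |a γ| ≤ c * dist z ((γ : SL(2, ℝ)) • z) := by
    obtain ⟨ε, hε0, hε⟩ := hε
    refine ⟨max (1 - ε) 0, le_max_right _ _, max_lt (by linarith) one_pos, fun γ z ↦ ?_⟩
    by_cases h0 : transLen (γ : SL(2, ℝ)) = 0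
    · rw [map_eq_zero_of_transLen_eq_zero Γ a ha γ h0, abs_zero]
      positivity
    · have hL : 0 ≤ transLen (γ : SL(2, ℝ)) := Real.iInf_nonneg fun _ ↦ dist_nonneg
      exact (hε γ h0).trans
        (mul_le_mul (le_max_left _ _) (transLen_le_dist _ z) hL (le_max_right _ _))
  have key : ∀ (γ : Γ) (P Q : SL(2, ℝ)), (γ : SL(2, ℝ)) * P * Xmat (a γ) = Q →
      dist (P • I) ((γ : SL(2, ℝ)) • P • I) ≤ dist (P • I) (Q • I) + |a γ| := by
    rintro γ P Q rfl
    refine (dist_triangle _ _ _).trans (add_le_add_right (le_of_eq ?_) _)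
    rw [mul_smul, mul_smul, dist_smul, dist_smul, dist_comm, dist_I_Xmat_smul]
  refine ⟨fun γ P h ↦ ?_, fun V hV ↦ ?_⟩
  · have h1 := key γ P P h
    rw [dist_self, zero_add] at h1
    have h0 : a γ = 0 := by
      have := (hc γ (P • I)).trans (mul_le_mul_of_nonneg_left h1 hc0)
      exact abs_eq_zero.1 (by nlinarith [abs_nonneg (a γ)])
    have hX : Xmat 0 = 1 := by
      ext i j
      fin_cases i <;> fin_cases j <;> simp [Xmat]
    rw [h0, hX, mul_one] at h
    exact Subtype.ext (mul_eq_right.1 h)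
  · obtain ⟨C, hC⟩ := (hV.image continuous_dist_I_smul).bddAbove
    refine (finite_dist_I_smul_le Γ (4 * C + c * (2 * C) / (1 - c))).subset ?_
    rintro γ ⟨P, hP, hQ⟩
    have h1 := key γ P _ rfl
    have hPC : dist I (P • I) ≤ C := hC (Set.mem_image_of_mem _ hP)
    have hQC := hC (Set.mem_image_of_mem (fun g : SL(2, ℝ) ↦ dist I (g • I)) hQ)
    have h2 := dist_triangle_left (P • I) (((γ : SL(2, ℝ)) * P * Xmat (a γ)) • I) I
    have h3 : |a γ| ≤ c * (2 * C) / (1 - c) := by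
      rw [le_div_iff₀ (by linarith)]
      have := (hc γ (P • I)).trans (mul_le_mul_of_nonneg_left
        (h1.trans (add_le_add_left (h2.trans (add_le_add hPC hQC)) _)) hc0)
      linarith
    have h4 : dist ((γ : SL(2, ℝ)) • P • I) ((γ : SL(2, ℝ)) • I) ≤ C := by
      rwa [dist_smul, dist_comm]
    have h5 := dist_triangle4 I (P • I) ((γ : SL(2, ℝ)) • P • I) ((γ : SL(2, ℝ)) • I)
    simp only [Set.mem_ofPred_eq] at hQC ⊢
    linarith
end

section
/- Let Φ be a continuous flow on a topological space M and let α be a continuous cocycle over Φ. Then for all p ∈ M and all real numbers T and t, ∫₀^T α(Φ^s(p), t) ds = ∫₀^t α(Φ^u(p), T) du. -/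
/-- The integral of the increments `g (s + t) - g s` over `[0, T]` in terms of the primitive of
`g` based at `0`. -/
theorem intervalIntegral_add_right_sub {g : ℝ → ℝ} (hg : Continuous g) (T t : ℝ) :
    ∫ s in (0 : ℝ)..T, (g (s + t) - g s) =
      (∫ s in (0 : ℝ)..(T + t), g s) - (∫ s in (0 : ℝ)..t, g s) - ∫ s in (0 : ℝ)..T, g s := by
  have hint (a b : ℝ) : IntervalIntegrable g MeasureTheory.volume a b := hg.intervalIntegrable a b
  have hshift : Continuous fun s => g (s + t) := by fun_prop
  rw [intervalIntegral.integral_sub (hshift.intervalIntegrable _ _) (hint _ _),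
    intervalIntegral.integral_comp_add_right, zero_add,
    intervalIntegral.integral_interval_sub_left (hint _ _) (hint _ _)]

/-- Let `Φ` be a continuous flow on a topological space `M` and `α` a continuous
cocycle over `Φ`.  Then `∫₀^T α(Φ^s(p), t) ds = ∫₀^t α(Φ^u(p), T) du` for all `p ∈ M`
and all real `T`, `t`. -/
theorem cocycle_integral_symm {M : Type*} [TopologicalSpace M]
    (Φ : ℝ → M → M)
    (hΦcont : Continuous fun q : ℝ × M => Φ q.1 q.2)
    (hΦ0 : ∀ p, Φ 0 p = p)
    (hΦadd : ∀ t s p, Φ (t + s) p = Φ t (Φ s p))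
    (α : M → ℝ → ℝ)
    (hαcont : Continuous fun q : M × ℝ => α q.1 q.2)
    (hcoc : ∀ p t t', α p (t + t') = α (Φ t p) t' + α p t)
    (p : M) (T t : ℝ) :
    ∫ s in (0 : ℝ)..T, α (Φ s p) t = ∫ u in (0 : ℝ)..t, α (Φ u p) T := by
  have hg : Continuous (α p) := hαcont.comp (Continuous.prodMk_right p)
  have hincr (s r : ℝ) : α (Φ s p) r = α p (s + r) - α p s := by rw [hcoc p s r]; ring
  simp only [hincr]
  rw [intervalIntegral_add_right_sub hg, intervalIntegral_add_right_sub hg, add_comm t T]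
  ring
end

section
/- Let Φ be a continuous flow on a topological space M and let α be a continuous cocycle over Φ. Suppose there exist T > 0 and λ' ∈ ℝ such that α(q, T) ≥ λ'·T for every q ∈ M. Define β : M → ℝ by β(p) = (1/T)·∫₀^T α(p, s) ds. Then for every p ∈ M and every t ≥ 0, α(p,t) + β(Φ^t(p)) − β(p) ≥ λ'·t. -/
open MeasureTheory in
/-- If the increments of a continuous function over steps of length `T` are at least `c`, then
its integrals over windows of length `T` grow at rate at least `c`. -/
theorem mul_le_integral_window_sub {f : ℝ → ℝ} (hf : Continuous f) {T c : ℝ}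
    (h : ∀ s, c ≤ f (s + T) - f s) {t : ℝ} (ht : 0 ≤ t) :
    t * c ≤ (∫ s in t..t + T, f s) - ∫ s in (0 : ℝ)..T, f s := by
  have hi : ∀ a b, IntervalIntegrable f volume a b := hf.intervalIntegrable
  have hshift : Continuous fun s => f (s + T) := by fun_prop
  have hle : ∫ _ in (0 : ℝ)..t, c ≤ ∫ s in (0 : ℝ)..t, (f (s + T) - f s) :=
    intervalIntegral.integral_mono_on ht intervalIntegrable_const
      ((hshift.sub hf).intervalIntegrable 0 t) fun s _ => h s
  rw [intervalIntegral.integral_sub (hshift.intervalIntegrable 0 t) (hi 0 t),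
    intervalIntegral.integral_comp_add_right, intervalIntegral.integral_const, zero_add,
    sub_zero, smul_eq_mul] at hle
  have h₁ := intervalIntegral.integral_add_adjacent_intervals (hi 0 t) (hi t (t + T))
  have h₂ := intervalIntegral.integral_add_adjacent_intervals (hi 0 T) (hi T (t + T))
  linarith

/-- Let `Φ` be a continuous flow on a topological space `M` and `α` a continuous
cocycle over `Φ`.  Suppose `T > 0` and `λ'` are such that `α(q, T) ≥ λ'·T` for all
`q ∈ M`, and let `β(p) = (1/T)·∫₀^T α(p, s) ds`.  Then
`α(p,t) + β(Φ^t(p)) - β(p) ≥ λ'·t` for every `p ∈ M` and `t ≥ 0`. -/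
theorem cocycle_averaging_bound {M : Type*} [TopologicalSpace M]
    (Φ : ℝ → M → M)
    (hΦcont : Continuous fun q : ℝ × M => Φ q.1 q.2)
    (hΦ0 : ∀ p, Φ 0 p = p)
    (hΦadd : ∀ t s p, Φ (t + s) p = Φ t (Φ s p))
    (α : M → ℝ → ℝ)
    (hαcont : Continuous fun q : M × ℝ => α q.1 q.2)
    (hcoc : ∀ p t t', α p (t + t') = α (Φ t p) t' + α p t)
    (T : ℝ) (hT : 0 < T) (lam' : ℝ)
    (hα : ∀ q : M, α q T ≥ lam' * T)
    (β : M → ℝ)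
    (hβ : ∀ p, β p = (1 / T) * ∫ s in (0 : ℝ)..T, α p s) :
    ∀ p : M, ∀ t : ℝ, 0 ≤ t → α p t + β (Φ t p) - β p ≥ lam' * t := by
  intro p t ht
  have hf : Continuous (α p) := hαcont.comp (Continuous.prodMk_right p)
  have hstep : ∀ s, lam' * T ≤ α p (s + T) - α p s := fun s => by
    linarith [hcoc p s T, hα (Φ s p)]
  have hwindow := mul_le_integral_window_sub hf hstep ht
  have horbit : ∫ s in (0 : ℝ)..T, α (Φ t p) s = (∫ s in t..t + T, α p s) - T * α p t := by
    have hshift : Continuous fun s => α p (t + s) := by fun_prop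
    have hcongr : ∀ s, α (Φ t p) s = α p (t + s) - α p t := fun s => by
      linarith [hcoc p t s]
    simp_rw [hcongr]
    rw [intervalIntegral.integral_sub (hshift.intervalIntegrable 0 T) intervalIntegrable_const,
      intervalIntegral.integral_comp_add_left, intervalIntegral.integral_const, add_zero,
      sub_zero, smul_eq_mul]
  have hdiff : α p t + β (Φ t p) - β p =
      ((∫ s in t..t + T, α p s) - ∫ s in (0 : ℝ)..T, α p s) / T := by
    rw [hβ, hβ, horbit]
    field_simp
    ring
  rw [hdiff, ge_iff_le, le_div_iff₀ hT]
  linarith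
end
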